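/- For a positive integer M, let p(M, N) denote the number of partitions of M into exactly N parts, and let N_cr(M) denote a value of N at which N ↦ p(M, N) attains its maximum. Then N_cr(M) ~ (√6/(2π)) · √M · ln M as M → ∞, i.e. N_cr(M) / (√M ln M) → √6/(2π). -/

import Mathlib

/-- The number of partitions of `M` into exactly `N` parts. -/
def partitionsWithParts (M N : ℕ) : ℕ :=
  (Finset.univ.filter fun p : Nat.Partition M => p.parts.card = N).card

open Finset

/-- add `k` copies of `v` -/
def addCopies {n m : ℕ} (k v : ℕ) (hv : 0 < v) (h : m + k * v = n) (p : Nat.Partition m) :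
    Nat.Partition n where
  parts := p.parts + Multiset.replicate k v
  parts_pos := by
    intro i hi
    rcases Multiset.mem_add.1 hi with h1 | h1
    · exact p.parts_pos h1
    · rw [Multiset.eq_of_mem_replicate h1]; exact hv
  parts_sum := by
    simp [p.parts_sum, h]

lemma card_le_card_count {n k v : ℕ} (hv : 0 < v) (h : k * v ≤ n) :
    Fintype.card (Nat.Partition (n - k * v)) ≤
      (univ.filter fun p : Nat.Partition n => k ≤ p.parts.count v).card := by
  rw [← Finset.card_univ]
  apply Finset.card_le_card_of_injOn (addCopies k v hv (Nat.sub_add_cancel h))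
  · intro p _
    simp [addCopies]
  · intro p _ q _ hpq
    have := congrArg Nat.Partition.parts hpq
    simp only [addCopies, add_left_inj] at this
    exact Nat.Partition.ext this

lemma part_mono : Monotone fun n => Fintype.card (Nat.Partition n) := by
  apply monotone_nat_of_le_succ
  intro n
  have := card_le_card_count (n := n + 1) (k := 1) (v := 1) one_pos (by omega)
  simp only [mul_one, Nat.add_sub_cancel] at this
  exact this.trans (Finset.card_le_univ _)

lemma sum_count_le (n : ℕ) :
    ∑ k ∈ Icc 1 n, ∑ v ∈ range (n + 1),
      v * (univ.filter fun p : Nat.Partition n => k ≤ p.parts.count v).card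
      ≤ n * Fintype.card (Nat.Partition n) := by
  have h1 : ∀ p : Nat.Partition n, ∑ v ∈ range (n + 1), p.parts.count v * v = n := by
    intro p
    conv_rhs => rw [← p.parts_sum]
    rw [Finset.sum_multiset_count_of_subset p.parts (range (n + 1))]
    · simp
    · intro i hi
      have := p.le_of_mem_parts (Multiset.mem_toFinset.1 hi)
      simp; omega
  calc _ = ∑ p : Nat.Partition n, ∑ v ∈ range (n + 1), v *
        ((Icc 1 n).filter fun k => k ≤ p.parts.count v).card := by
        simp_rw [Finset.card_filter, Finset.mul_sum]
        rw [Finset.sum_comm]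
        rw [Finset.sum_comm' (s := univ) (t' := range (n+1)) (s' := fun _ => univ) (by simp)]
        apply Finset.sum_congr rfl
        intro v _
        rw [Finset.sum_comm]
    _ ≤ ∑ p : Nat.Partition n, ∑ v ∈ range (n + 1), p.parts.count v * v := by
        apply Finset.sum_le_sum
        intro p _
        apply Finset.sum_le_sum
        intro v _
        rw [mul_comm]
        apply Nat.mul_le_mul_right
        calc _ ≤ (Icc 1 (p.parts.count v)).card := by
              apply Finset.card_le_card
              intro k hk
              simp at hk ⊢
              omega
          _ = _ := by simp
    _ = _ := by
        simp_rw [h1]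
        simp [mul_comm]

lemma pwp_zero (M : ℕ) : partitionsWithParts M 0 ≤ 1 := by
  unfold partitionsWithParts
  rw [Finset.card_le_one]
  intro a ha b hb
  simp at ha hb
  exact Nat.Partition.ext (ha.trans hb.symm)

lemma pwp_eq_zero {M N : ℕ} (h : M < N) : partitionsWithParts M N = 0 := by
  unfold partitionsWithParts
  rw [Finset.card_eq_zero, Finset.filter_eq_empty_iff]
  intro p _ hp
  have : p.parts.card ≤ p.parts.sum := by
    have := Multiset.card_nsmul_le_sum (s := p.parts) (a := 1) (fun x hx => p.parts_pos hx)
    simpa using this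
  rw [p.parts_sum] at this
  omega

lemma sum_pwp (M : ℕ) :
    ∑ N ∈ range (M + 1), partitionsWithParts M N = Fintype.card (Nat.Partition M) := by
  unfold partitionsWithParts
  rw [← Finset.card_univ]
  symm
  apply Finset.card_eq_sum_card_fiberwise
  intro p _
  have : p.parts.card ≤ p.parts.sum := by
    have := Multiset.card_nsmul_le_sum (s := p.parts) (a := 1) (fun x hx => p.parts_pos hx)
    simpa using this
  rw [p.parts_sum] at this
  simp; omega

/-- remove a one -/
def removeOne {M : ℕ} (p : Nat.Partition (M + 1)) (h : 1 ∈ p.parts) : Nat.Partition M where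
  parts := p.parts.erase 1
  parts_pos := fun hi => p.parts_pos (Multiset.mem_of_mem_erase hi)
  parts_sum := by
    have := Multiset.sum_erase h
    rw [p.parts_sum] at this
    omega

lemma sum_pred (s : Multiset ℕ) (h : ∀ x ∈ s, 0 < x) :
    (s.map Nat.pred).sum + s.card = s.sum := by
  induction s using Multiset.induction with
  | empty => simp
  | cons a s ih =>
    have := ih (fun x hx => h x (Multiset.mem_cons_of_mem hx))
    have := h a (Multiset.mem_cons_self a s)
    simp only [Multiset.map_cons, Multiset.sum_cons, Multiset.card_cons, Nat.pred_eq_sub_one] at *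
    omega

lemma map_pred_succ (s : Multiset ℕ) (h : ∀ x ∈ s, 0 < x) :
    (s.map Nat.pred).map Nat.succ = s := by
  rw [Multiset.map_map]
  conv_rhs => rw [← Multiset.map_id s]
  apply Multiset.map_congr rfl
  intro x hx
  have := h x hx
  simp; omega

/-- subtract one from every part -/
def predPart {M N : ℕ} (p : Nat.Partition M) (h : 1 ∉ p.parts) (hN : p.parts.card = N) :
    Nat.Partition (M - N) where
  parts := p.parts.map Nat.pred
  parts_pos := by
    intro i hi
    rcases Multiset.mem_map.1 hi with ⟨x, hx, rfl⟩
    have := p.parts_pos hx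
    have : x ≠ 1 := fun h' => h (h' ▸ hx)
    simp; omega
  parts_sum := by
    have := sum_pred p.parts (fun x hx => p.parts_pos hx)
    rw [p.parts_sum, hN] at this
    omega

lemma pwp_rec (M N : ℕ) : partitionsWithParts (M + 1) (N + 1) ≤
    partitionsWithParts M N + partitionsWithParts (M - N) (N + 1) := by
  have key : partitionsWithParts (M + 1) (N + 1) =
    (univ.filter fun p : Nat.Partition (M + 1) => p.parts.card = N + 1 ∧ 1 ∈ p.parts).card +
    (univ.filter fun p : Nat.Partition (M + 1) => p.parts.card = N + 1 ∧ 1 ∉ p.parts).card := by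
    unfold partitionsWithParts
    rw [← Finset.card_filter_add_card_filter_not (fun p : Nat.Partition (M + 1) => 1 ∈ p.parts)]
    rw [Finset.filter_filter, Finset.filter_filter]
  rw [key]
  unfold partitionsWithParts
  apply Nat.add_le_add
  · apply Finset.card_le_card_of_injOn
      (fun p => if h : 1 ∈ p.parts then removeOne p h else Nat.Partition.indiscrete M)
    · intro p hp
      simp at hp
      simp [hp.2, removeOne, Multiset.card_erase_of_mem hp.2, hp.1]
    · intro p hp q hq hpq
      simp at hp hq
      simp only [hp.2, hq.2, dif_pos] at hpq
      have := congrArg Nat.Partition.parts hpq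
      simp only [removeOne] at this
      apply Nat.Partition.ext
      rw [← Multiset.cons_erase hp.2, ← Multiset.cons_erase hq.2, this]
  · have e : M + 1 - (N + 1) = M - N := by omega
    rw [← e]
    apply Finset.card_le_card_of_injOn
      (fun p => if h : 1 ∉ p.parts ∧ p.parts.card = N + 1 then predPart p h.1 h.2
        else Nat.Partition.indiscrete _)
    · intro p hp
      simp at hp
      simp [hp.2, hp.1, predPart]
    · intro p hp q hq hpq
      simp at hp hq
      simp only [hp.1, hp.2, hq.1, hq.2, not_false_eq_true, and_self, dif_pos] at hpq
      have := congrArg Nat.Partition.parts hpq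
      simp only [predPart] at this
      apply Nat.Partition.ext
      rw [← map_pred_succ p.parts (fun x hx => p.parts_pos hx),
        ← map_pred_succ q.parts (fun x hx => q.parts_pos hx), this]

lemma pwp_le_sum (N : ℕ) : ∀ M, N ≤ M → partitionsWithParts M N ≤
    ∑ i ∈ range (N + 1), partitionsWithParts (M - N) i := by
  induction N with
  | zero => intro M _; simp
  | succ N ih =>
    intro M hM
    obtain ⟨M, rfl⟩ : ∃ M', M = M' + 1 := ⟨M - 1, by omega⟩
    rw [Finset.sum_range_succ]
    have e : M + 1 - (N + 1) = M - N := by omega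
    rw [e]
    exact (pwp_rec M N).trans (Nat.add_le_add_right (ih M (by omega)) _)

lemma pwp_le (M N : ℕ) (h : N ≤ M) :
    partitionsWithParts M N ≤ Fintype.card (Nat.Partition (M - N)) := by
  refine (pwp_le_sum N M h).trans ?_
  rw [← sum_pwp]
  calc _ ≤ ∑ i ∈ range (max (N + 1) (M - N + 1)), partitionsWithParts (M - N) i := by
        apply Finset.sum_le_sum_of_subset
        intro x; simp; omega
    _ = _ := by
        symm
        apply Finset.sum_subset
        · intro x; simp; omega
        · intro x _ hx
          apply pwp_eq_zero
          simp at hx; omega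

lemma pwp_gen (q : ℝ) (h0 : 0 < q) (h1 : q < 1) (N : ℕ) : ∀ M,
    (partitionsWithParts M N : ℝ) * q ^ M ≤ ∏ j ∈ range N, (1 - q ^ (j + 1))⁻¹ := by
  induction N with
  | zero =>
    intro M
    simp only [range_zero, prod_empty]
    have : (partitionsWithParts M 0 : ℝ) ≤ 1 := by exact_mod_cast pwp_zero M
    have h2 : q ^ M ≤ 1 := pow_le_one₀ h0.le h1.le
    have : 0 ≤ q ^ M := by positivity
    nlinarith
  | succ N ih =>
    have hq : ∀ j : ℕ, 0 < 1 - q ^ (j + 1) := fun j => by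
      have := pow_lt_one₀ h0.le h1 (Nat.succ_ne_zero j)
      simpa using this
    set G := ∏ j ∈ range N, (1 - q ^ (j + 1))⁻¹ with hG
    have hGpos : 0 < G := Finset.prod_pos fun j _ => inv_pos.2 (hq j)
    rw [Finset.prod_range_succ, ← hG]
    set G' := G * (1 - q ^ (N + 1))⁻¹ with hG'
    have hrel : G = (1 - q ^ (N + 1)) * G' := by
      rw [hG']; field_simp [(hq N).ne']
    have hG'pos : 0 < G' := mul_pos hGpos (inv_pos.2 (hq N))
    intro M
    induction M using Nat.strong_induction_on with
    | _ M ihM =>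
    rcases Nat.lt_or_ge M (N + 1) with hlt | hge
    · rw [pwp_eq_zero hlt]; simp; exact hG'pos.le
    · obtain ⟨M, rfl⟩ : ∃ M', M = M' + 1 := ⟨M - 1, by omega⟩
      have hr : (partitionsWithParts (M + 1) (N + 1) : ℝ) ≤
        partitionsWithParts M N + partitionsWithParts (M - N) (N + 1) := by
        exact_mod_cast pwp_rec M N
      have a1 := ih M
      have a2 := ihM (M - N) (by omega)
      have e : q ^ (M + 1) = q ^ (M - N) * q ^ (N + 1) := by
        rw [← pow_add]; congr 1; omega
      calc (partitionsWithParts (M + 1) (N + 1) : ℝ) * q ^ (M + 1)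
          ≤ (partitionsWithParts M N + partitionsWithParts (M - N) (N + 1)) * q ^ (M + 1) := by
            gcongr
        _ = (partitionsWithParts M N * q ^ M) * q +
            (partitionsWithParts (M - N) (N + 1) * q ^ (M - N)) * q ^ (N + 1) := by
            rw [add_mul]
            congr 1
            · rw [pow_succ]; ring
            · rw [e]; ring
        _ ≤ G * 1 + G' * q ^ (N + 1) := by gcongr
        _ = G' := by rw [hrel]; ring

/-- the partition function, real valued -/
noncomputable def PP (n : ℕ) : ℝ := (Fintype.card (Nat.Partition n) : ℝ)
/-- partial sums of `PP` -/
noncomputable def RR (n : ℕ) : ℝ := ∑ i ∈ range n, PP i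
/-- iterated partial sums of `PP` -/
noncomputable def QQ (n : ℕ) : ℝ := ∑ i ∈ range n, ((n : ℝ) - i) * PP i
/-- the harmonic numbers -/
noncomputable def HH (n : ℕ) : ℝ := ∑ k ∈ Icc 1 n, 1 / (k : ℝ)
/-- the constant `π / √6` -/
noncomputable def lam : ℝ := Real.pi / Real.sqrt 6
/-- barrier -/
noncomputable def ww (n : ℕ) : ℝ := Real.sqrt n / lam + (HH n + 10)

lemma PP_mono : Monotone PP := fun a b h => by
  unfold PP; exact_mod_cast part_mono h

lemma PP_one_le (n : ℕ) : 1 ≤ PP n := by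
  have h0 : PP 0 = 1 := by simp [PP]
  rw [← h0]; exact PP_mono (Nat.zero_le n)

lemma PP_pos (n : ℕ) : 0 < PP n := lt_of_lt_of_le one_pos (PP_one_le n)

lemma RR_succ (n : ℕ) : RR (n + 1) = RR n + PP n := by
  simp [RR, Finset.sum_range_succ]

lemma QQ_succ (n : ℕ) : QQ (n + 1) = QQ n + RR (n + 1) := by
  unfold QQ RR
  rw [Finset.sum_range_succ, Finset.sum_range_succ, ← add_assoc, ← Finset.sum_add_distrib]
  push_cast
  congr 1
  · apply Finset.sum_congr rfl; intro i _; ring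
  · ring

lemma RR_nonneg (n : ℕ) : 0 ≤ RR n := Finset.sum_nonneg fun i _ => (PP_pos i).le

lemma RR_zero : RR 0 = 0 := by simp [RR]
lemma QQ_zero : QQ 0 = 0 := by simp [QQ]

lemma QQ_nonneg (n : ℕ) : 0 ≤ QQ n := by
  induction n with
  | zero => simp [QQ_zero]
  | succ n ih => rw [QQ_succ]; linarith [RR_nonneg (n + 1)]

lemma RR_le_QQ (n : ℕ) : RR n ≤ QQ n := by
  cases n with
  | zero => simp [QQ_zero, RR_zero]
  | succ n => rw [QQ_succ]; linarith [QQ_nonneg n]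

lemma QQ_le_mul_RR (n : ℕ) : QQ n ≤ n * RR n := by
  unfold QQ RR
  rw [Finset.mul_sum]
  gcongr with i _
  · exact (PP_pos i).le
  · simp

lemma RR_le (n : ℕ) : RR n ≤ n * PP n := by
  unfold RR
  calc _ ≤ ∑ i ∈ range n, PP n := by
        apply Finset.sum_le_sum
        intro i hi
        exact PP_mono (Finset.mem_range.1 hi).le
    _ = _ := by simp

lemma QQ_le_sq (n : ℕ) : QQ n ≤ n ^ 2 * PP n := by
  have := QQ_le_mul_RR n
  have h2 := RR_le n
  nlinarith [mul_le_mul_of_nonneg_left h2 (Nat.cast_nonneg (α := ℝ) n)]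

lemma QQ_pos (n : ℕ) (hn : 1 ≤ n) : 0 < QQ n := by
  obtain ⟨m, rfl⟩ : ∃ m, n = m + 1 := ⟨n - 1, by omega⟩
  refine lt_of_lt_of_le ?_ (RR_le_QQ _)
  rw [RR_succ]; linarith [PP_pos m, RR_nonneg m]

lemma QQ_ge (m s : ℕ) : (s : ℝ) ^ 2 / 2 * PP m ≤ QQ (m + s) := by
  have hR : ∀ s : ℕ, (s : ℝ) * PP m ≤ RR (m + s) := by
    intro s
    induction s with
    | zero => simp [RR_nonneg]
    | succ s ih =>
      rw [← add_assoc, RR_succ]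
      have := PP_mono (Nat.le_add_right m s)
      push_cast; linarith
  induction s with
  | zero => simp [QQ_nonneg]
  | succ s ih =>
    have h := hR (s + 1)
    rw [← add_assoc] at h ⊢
    rw [QQ_succ]
    push_cast at h ⊢
    nlinarith [PP_pos m, (Nat.cast_nonneg s : (0 : ℝ) ≤ s)]

lemma QQ_le' (m s : ℕ) : QQ (m + s) ≤ (s + 1) * QQ m + s ^ 2 * PP (m + s) := by
  have hR : ∀ s : ℕ, RR (m + s) ≤ RR m + s * PP (m + s) := by
    intro s
    induction s with
    | zero => simp
    | succ s ih =>
      rw [← add_assoc, RR_succ]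
      have := PP_mono (Nat.le_succ (m + s))
      push_cast
      rw [Nat.succ_eq_add_one] at this
      nlinarith [(Nat.cast_nonneg s : (0 : ℝ) ≤ s)]
  have : QQ (m + s) ≤ QQ m + s * RR m + s ^ 2 * PP (m + s) := by
    induction s with
    | zero => simp
    | succ s ih =>
      have h := hR (s + 1)
      rw [← add_assoc] at h ⊢
      rw [QQ_succ]
      have := PP_mono (Nat.le_succ (m + s))
      rw [Nat.succ_eq_add_one] at this
      push_cast at h ⊢
      have h3 : (s : ℝ) ^ 2 * PP (m + s) ≤ (s : ℝ) ^ 2 * PP (m + s + 1) := by gcongr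
      nlinarith [(Nat.cast_nonneg s : (0 : ℝ) ≤ s), PP_pos (m + s + 1),
        mul_nonneg (Nat.cast_nonneg s : (0 : ℝ) ≤ s) (PP_pos (m + s + 1)).le]
  have h2 := RR_le_QQ m
  nlinarith [(Nat.cast_nonneg s : (0 : ℝ) ≤ s)]

/-- block comparison -/
lemma block (f : ℕ → ℝ) (hf : Antitone f) (hf0 : ∀ j, 0 ≤ f j) (k V : ℕ) :
    ∑ j ∈ range (k * V), (j : ℝ) * f j ≤
      (k : ℝ) ^ 2 * ∑ v ∈ range V, (v : ℝ) * f (k * v) + k * ∑ j ∈ range (k * V), f j := by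
  induction V with
  | zero => simp
  | succ V ih =>
    rw [Nat.mul_succ, Finset.sum_range_add, Finset.sum_range_add _ (k * V) k,
      Finset.sum_range_succ _ V]
    have : ∑ r ∈ range k, ((k * V + r : ℕ) : ℝ) * f (k * V + r) ≤
        (k : ℝ) ^ 2 * (V * f (k * V)) + k * ∑ r ∈ range k, f (k * V + r) := by
      rw [Finset.mul_sum]
      have e : (k : ℝ) ^ 2 * (V * f (k * V)) = ∑ r ∈ range k, (k * V : ℝ) * f (k * V) := by
        simp; ring
      rw [e, ← Finset.sum_add_distrib]
      apply Finset.sum_le_sum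
      intro r hr
      have hr' : (r : ℝ) ≤ k := by exact_mod_cast (Finset.mem_range.1 hr).le
      have h1 : f (k * V + r) ≤ f (k * V) := hf (Nat.le_add_right _ _)
      have h2 := hf0 (k * V + r)
      push_cast
      have h3 : (k * V : ℝ) * f (k * V + r) ≤ (k * V : ℝ) * f (k * V) := by gcongr
      nlinarith [mul_le_mul_of_nonneg_right hr' h2]
    linarith

lemma rec_ineq_k (n k : ℕ) (hk : 1 ≤ k) :
    QQ n / k ^ 2 - (PP n + RR n) / k ≤
      ∑ v ∈ range (n + 1), (v : ℝ) * (if k * v ≤ n then PP (n - k * v) else 0) := by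
  set f : ℕ → ℝ := fun j => if j ≤ n then PP (n - j) else 0 with hf
  have hf0 : ∀ j, 0 ≤ f j := by
    intro j; simp only [hf]; split_ifs
    · exact (PP_pos _).le
    · exact le_rfl
  have hfa : Antitone f := by
    intro a b hab
    simp only [hf]
    split_ifs with h1 h2 h2
    · exact PP_mono (by omega)
    · omega
    · exact (PP_pos _).le
    · exact le_rfl
  have hb := block f hfa hf0 k (n + 1)
  have ext : ∀ g : ℕ → ℝ, ∑ j ∈ range (k * (n + 1)), g j * f j =
      ∑ j ∈ range (n + 1), g j * f j := by
    intro g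
    symm
    apply Finset.sum_subset
    · intro x hx
      simp only [Finset.mem_range] at hx ⊢
      nlinarith
    · intro x _ hx
      simp only [Finset.mem_range] at hx
      simp only [hf]
      rw [if_neg (by omega)]; simp
  have e1 : ∑ j ∈ range (k * (n + 1)), (j : ℝ) * f j = QQ n := by
    rw [ext (fun j => (j : ℝ)), ← Finset.sum_range_reflect]
    unfold QQ
    rw [Finset.sum_range_succ]
    simp only [hf]
    simp only [Nat.add_sub_cancel, Nat.sub_self, Nat.cast_zero, zero_mul, add_zero]
    apply Finset.sum_congr rfl
    intro i hi
    have hi := Finset.mem_range.1 hi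
    rw [if_pos (by omega), Nat.sub_sub_self hi.le, Nat.cast_sub hi.le]
  have e2 : ∑ j ∈ range (k * (n + 1)), f j = PP n + RR n := by
    have := ext (fun j => 1)
    simp only [one_mul] at this
    rw [this, ← Finset.sum_range_reflect, Finset.sum_range_succ, add_comm]
    unfold RR
    simp only [hf]
    congr 1
    · simp
    apply Finset.sum_congr rfl
    intro i hi
    have hi := Finset.mem_range.1 hi
    rw [if_pos (by omega)]; congr 1; omega
  rw [e1, e2] at hb
  have hk' : (0 : ℝ) < k := by exact_mod_cast hk
  have : QQ n / k ^ 2 - (PP n + RR n) / k = (QQ n - k * (PP n + RR n)) / k ^ 2 := by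
    field_simp
  rw [this, div_le_iff₀ (by positivity)]
  simp only [hf] at hb
  linarith

lemma zeta_partial (n : ℕ) (hn : 1 ≤ n) :
    Real.pi ^ 2 / 6 - 1 / n ≤ ∑ k ∈ Icc 1 n, 1 / (k : ℝ) ^ 2 := by
  have hs : ∀ n : ℕ, ∑ k ∈ Icc 1 n, 1 / (k : ℝ) ^ 2 = ∑ k ∈ range (n + 1), 1 / (k : ℝ) ^ 2 := by
    intro n
    rw [Finset.sum_range_succ']
    simp only [Nat.cast_zero, ne_eq, OfNat.ofNat_ne_zero, not_false_eq_true, zero_pow, div_zero,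
      add_zero]
    rw [Finset.range_eq_Ico, Finset.sum_Ico_add' (fun k : ℕ => 1 / (k : ℝ) ^ 2) 0 n 1]
    rfl
  set g : ℕ → ℝ := fun m => ∑ k ∈ range (m + 2), 1 / (k : ℝ) ^ 2 + 1 / ((m : ℝ) + 1) with hg
  have hanti : Antitone g := by
    apply antitone_nat_of_succ_le
    intro m
    simp only [hg]
    rw [Finset.sum_range_succ _ (m + 2)]
    push_cast
    have : 1 / ((m : ℝ) + 2) ^ 2 + 1 / ((m : ℝ) + 1 + 1) ≤ 1 / ((m : ℝ) + 1) := by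
      have hm : (0 : ℝ) ≤ m := Nat.cast_nonneg m
      rw [show (m : ℝ) + 1 + 1 = m + 2 by ring, div_add_div _ _ (by positivity) (by positivity),
        div_le_div_iff₀ (by positivity) (by positivity)]
      nlinarith [mul_nonneg hm hm, mul_nonneg hm (mul_nonneg hm hm)]
    linarith
  have ht : Filter.Tendsto g Filter.atTop (nhds (Real.pi ^ 2 / 6 + 0)) := by
    apply Filter.Tendsto.add
    · exact (hasSum_zeta_two.tendsto_sum_nat).comp (Filter.tendsto_add_atTop_nat 2)
    · exact tendsto_one_div_add_atTop_nhds_zero_nat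
  have := hanti.le_of_tendsto ht (n - 1)
  simp only [hg] at this
  rw [hs]
  have e : n - 1 + 2 = n + 1 := by omega
  rw [e, Nat.cast_sub hn] at this
  simp at this ⊢
  linarith

lemma lam_sq : lam ^ 2 = Real.pi ^ 2 / 6 := by
  unfold lam; rw [div_pow, Real.sq_sqrt (by norm_num)]

lemma lam_pos : 0 < lam := by unfold lam; positivity

lemma lam_sq_ge : 3 / 2 ≤ lam ^ 2 := by
  rw [lam_sq]; nlinarith [Real.pi_gt_three]

lemma lam_sq_le : lam ^ 2 ≤ 2 := by
  rw [lam_sq]; nlinarith [Real.pi_lt_d2, Real.pi_pos]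

lemma one_le_lam : 1 ≤ lam := by nlinarith [lam_sq_ge, lam_pos]

lemma lam_le_two : lam ≤ 2 := by nlinarith [lam_sq_le, lam_pos]

lemma rec_ineq (n : ℕ) (hn : 1 ≤ n) :
    (lam ^ 2 - 1 / n) * QQ n - HH n * (PP n + RR n) ≤ n * PP n := by
  have h1 := sum_count_le n
  have h2 : ∑ k ∈ Icc 1 n, ∑ v ∈ range (n + 1),
      (v : ℝ) * (if k * v ≤ n then PP (n - k * v) else 0) ≤ n * PP n := by
    unfold PP
    refine le_trans ?_ (show ((∑ k ∈ Icc 1 n, ∑ v ∈ range (n + 1),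
      v * (univ.filter fun p : Nat.Partition n => k ≤ p.parts.count v).card : ℕ) : ℝ) ≤ _ by
      exact_mod_cast h1)
    push_cast
    apply Finset.sum_le_sum
    intro k _
    apply Finset.sum_le_sum
    intro v _
    rcases Nat.eq_zero_or_pos v with rfl | hv
    · simp
    · gcongr
      split_ifs with h
      · exact_mod_cast card_le_card_count hv h
      · positivity
  refine le_trans ?_ h2
  calc _ ≤ (∑ k ∈ Icc 1 n, 1 / (k : ℝ) ^ 2) * QQ n - HH n * (PP n + RR n) := by
        rw [lam_sq]
        have := mul_le_mul_of_nonneg_right (zeta_partial n hn) (QQ_nonneg n)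
        linarith
    _ = ∑ k ∈ Icc 1 n, (QQ n / (k : ℝ) ^ 2 - (PP n + RR n) / k) := by
        unfold HH
        rw [Finset.sum_sub_distrib, Finset.sum_mul, Finset.sum_mul]
        congr 1
        · apply Finset.sum_congr rfl; intro k _; ring
        · apply Finset.sum_congr rfl; intro k _; ring
    _ ≤ _ := by
        apply Finset.sum_le_sum
        intro k hk
        exact rec_ineq_k n k (Finset.mem_Icc.1 hk).1

lemma HH_succ (n : ℕ) : HH (n + 1) = HH n + 1 / ((n : ℝ) + 1) := by
  unfold HH
  rw [Finset.sum_Icc_succ_top (by omega)]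
  push_cast; rfl

lemma HH_nonneg (n : ℕ) : 0 ≤ HH n := Finset.sum_nonneg fun i _ => by positivity

lemma HH_mono : Monotone HH := monotone_nat_of_le_succ fun n => by
  rw [HH_succ]
  have : 0 ≤ 1 / ((n : ℝ) + 1) := by positivity
  linarith

lemma HH_le (n : ℕ) : HH n ≤ 1 + Real.log n := by
  have := harmonic_le_one_add_log n
  rw [harmonic_eq_sum_Icc] at this
  push_cast at this
  unfold HH
  simpa using this

lemma ww_mono : Monotone ww := fun a b h => by
  unfold ww
  have := HH_mono h
  have := lam_pos
  gcongr

lemma ww_ge (n : ℕ) : 10 ≤ ww n := by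
  unfold ww
  have := HH_nonneg n
  have := lam_pos
  have : 0 ≤ √(n:ℝ) / lam := by positivity
  linarith

lemma ww_ineq (n : ℕ) (hn : 10 ≤ n) :
    n + HH n * ww n ≤ (lam ^ 2 - 1 / n) * (ww n * (ww n - 1)) := by
  have hn' : (10 : ℝ) ≤ n := by exact_mod_cast hn
  have hE : ∃ E, E = HH n + 10 := ⟨_, rfl⟩
  obtain ⟨E, hE⟩ := hE
  have hs : ∃ s, s = √(n:ℝ) := ⟨_, rfl⟩
  obtain ⟨s, hs⟩ := hs
  have hs2 : s ^ 2 = n := by rw [hs]; exact Real.sq_sqrt (by linarith)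
  have hs0 : 0 ≤ s := by rw [hs]; positivity
  have hH := HH_nonneg n
  have hl := lam_pos
  have hl2 := lam_sq_ge
  have hl3 := lam_sq_le
  have hl1 := one_le_lam
  set w := ww n with hw
  have hwE : w = s / lam + E := by rw [hw, ww, hs, hE]
  have hlw : lam * w = s + lam * E := by rw [hwE]; field_simp
  have hw10 : 10 ≤ w := ww_ge n
  have hE10 : 10 ≤ E := by linarith
  -- L w^2
  have a1 : lam ^ 2 * w ^ 2 = n + 2 * s * lam * E + lam ^ 2 * E ^ 2 := by
    rw [← mul_pow, hlw, ← hs2]; ring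
  have hsl : s / lam ≤ s := div_le_self hs0 hl1
  have a2 : w ^ 2 / n ≤ 2 + E ^ 2 / 5 := by
    rw [div_le_iff₀ (by linarith)]
    have : w ^ 2 ≤ (s + E) ^ 2 := by
      apply pow_le_pow_left₀ (by linarith); linarith
    nlinarith [sq_nonneg (s - E), sq_nonneg E]
  have a3 : (lam ^ 2 + HH n) * w ≤ E * s * lam + E ^ 2 := by
    have h1 : lam ^ 2 + HH n ≤ E := by linarith
    have h2 : w ≤ s + E := by linarith
    have h3 : s * E ≤ s * E * lam := le_mul_of_one_le_right (by positivity) hl1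
    have : 0 ≤ lam ^ 2 + HH n := by positivity
    nlinarith [mul_le_mul h1 h2 (by linarith) (by linarith)]
  have a4 : (lam ^ 2 - 1 / n) * (w * (w - 1)) =
      lam ^ 2 * w ^ 2 - w ^ 2 / n - lam ^ 2 * w + w / n := by ring
  have a5 : 0 ≤ w / n := by positivity
  have a6 : 0 ≤ s * lam * E := by positivity
  rw [a4, a1]
  nlinarith [sq_nonneg E]

lemma QQ_le_ww (n : ℕ) : QQ n ≤ ww n * RR n := by
  induction n with
  | zero => simp [QQ_zero, RR_zero]
  | succ n ih =>
    rcases Nat.lt_or_ge n 10 with h | h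
    · refine (QQ_le_mul_RR (n + 1)).trans ?_
      have : ((n + 1 : ℕ) : ℝ) ≤ 10 := by exact_mod_cast h
      have h2 := ww_ge (n + 1)
      have := RR_nonneg (n + 1)
      gcongr
      linarith
    · have hr := rec_ineq n (by omega)
      have hi := ww_ineq n h
      have hw := ww_ge n
      have hmono := ww_mono (Nat.le_succ n)
      have hn' : (10 : ℝ) ≤ n := by exact_mod_cast h
      have hH := HH_nonneg n
      have hQ := QQ_nonneg n
      have hR := RR_nonneg n
      have hP := PP_pos n
      -- Q ≤ (w - 1)(R + P)
      have key : QQ n ≤ (ww n - 1) * (RR n + PP n) := by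
        set w := ww n
        have b1 : n * RR n + (lam ^ 2 - 1 / n) * QQ n ≤ (n + HH n) * (RR n + PP n) := by linarith
        have b2 : (n + (lam ^ 2 - 1 / n) * w) * QQ n ≤ w * ((n + HH n) * (RR n + PP n)) := by
          nlinarith [mul_le_mul_of_nonneg_left b1 (by linarith : (0 : ℝ) ≤ w),
            mul_le_mul_of_nonneg_left ih (by linarith : (0 : ℝ) ≤ n)]
        have b3 : (n + HH n) * w ≤ (w - 1) * (n + (lam ^ 2 - 1 / n) * w) := by nlinarith
        have b4 : ((n + HH n) * w) * QQ n ≤ ((n + HH n) * w) * ((w - 1) * (RR n + PP n)) := by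
          calc _ ≤ ((w - 1) * (n + (lam ^ 2 - 1 / n) * w)) * QQ n := by gcongr
            _ = (w - 1) * ((n + (lam ^ 2 - 1 / n) * w) * QQ n) := by ring
            _ ≤ (w - 1) * (w * ((n + HH n) * (RR n + PP n))) := by
              apply mul_le_mul_of_nonneg_left b2; linarith
            _ = _ := by ring
        exact le_of_mul_le_mul_left b4 (by positivity)
      rw [QQ_succ, RR_succ]
      have : ww n * (RR n + PP n) ≤ ww (n + 1) * (RR n + PP n) := by
        apply mul_le_mul_of_nonneg_right hmono; linarith
      linarith

lemma QQ_step (n : ℕ) : QQ n ≤ QQ (n + 1) * Real.exp (-(1 / ww (n + 1))) := by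
  have h := QQ_le_ww (n + 1)
  have hw := ww_ge (n + 1)
  have hq := QQ_succ n
  have h1 : QQ (n + 1) / ww (n + 1) ≤ RR (n + 1) := by
    rw [div_le_iff₀ (by linarith)]; linarith
  have h2 := Real.add_one_le_exp (-(1 / ww (n + 1)))
  calc QQ n ≤ QQ (n + 1) * (-(1 / ww (n + 1)) + 1) := by
        have : QQ (n + 1) * (-(1 / ww (n + 1)) + 1) = QQ (n + 1) - QQ (n + 1) / ww (n + 1) := by
          ring
        linarith
    _ ≤ _ := mul_le_mul_of_nonneg_left h2 (QQ_nonneg _)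

lemma QQ_decay (m k : ℕ) : QQ m ≤ QQ (m + k) * Real.exp (-(k / ww (m + k))) := by
  induction k with
  | zero => simp
  | succ k ih =>
    rw [← add_assoc]
    have h1 := QQ_step (m + k)
    have hmono := ww_mono (Nat.le_succ (m + k))
    rw [Nat.succ_eq_add_one] at hmono
    have hw := ww_ge (m + k)
    have h2 : Real.exp (-(k / ww (m + k))) ≤ Real.exp (-(k / ww (m + k + 1))) := by
      gcongr
    calc _ ≤ _ := ih
      _ ≤ QQ (m + k) * Real.exp (-(k / ww (m + k + 1))) :=
        mul_le_mul_of_nonneg_left h2 (QQ_nonneg _)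
      _ ≤ (QQ (m + k + 1) * Real.exp (-(1 / ww (m + k + 1)))) *
          Real.exp (-(k / ww (m + k + 1))) := by gcongr
      _ = _ := by
        rw [mul_assoc, ← Real.exp_add]; congr 2; push_cast; ring

lemma QQ_lower (n : ℕ) (hn : 1 ≤ n) :
    Real.exp (2 * lam * √((n : ℝ) + 1) - 2 * lam * √2 -
      lam ^ 2 * ∑ j ∈ Icc 1 n, (HH j + 10) / j) ≤ QQ n := by
  induction n, hn using Nat.le_induction with
  | base =>
    have : QQ 1 = 1 := by simp [QQ, PP]
    rw [this, Real.exp_le_one_iff]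
    have := HH_nonneg 1
    have : 0 ≤ lam ^ 2 * (HH 1 + 10) := by positivity
    norm_num
    linarith
  | succ n hn ih =>
    have h := QQ_step n
    have hl := lam_pos
    rw [Finset.sum_Icc_succ_top (by omega)]
    set S := ∑ j ∈ Icc 1 n, (HH j + 10) / (j : ℝ)
    have h2 : QQ n * Real.exp (1 / ww (n + 1)) ≤ QQ (n + 1) := by
      calc _ ≤ (QQ (n + 1) * Real.exp (-(1 / ww (n + 1)))) * Real.exp (1 / ww (n + 1)) := by
            gcongr
        _ = _ := by rw [mul_assoc, ← Real.exp_add]; simp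
    refine le_trans ?_ h2
    refine le_trans ?_ (mul_le_mul_of_nonneg_right ih (Real.exp_pos _).le)
    rw [← Real.exp_add, Real.exp_le_exp]
    set E := HH (n + 1) + 10 with hE
    have hE0 : 0 < E := by have := HH_nonneg (n + 1); linarith
    set s := √((n : ℝ) + 1) with hs
    set s' := √(((n + 1 : ℕ) : ℝ) + 1) with hs'
    have hspos : 0 < s := by rw [hs]; positivity
    have hs2 : s ^ 2 = n + 1 := Real.sq_sqrt (by positivity)
    have hs2' : s' ^ 2 = n + 2 := by
      rw [hs', Real.sq_sqrt (by positivity)]; push_cast; ring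
    have hs'0 : 0 ≤ s' := by rw [hs']; positivity
    have hw : ww (n + 1) = s / lam + E := by
      rw [ww, ← hE, hs]; push_cast; rfl
    have c1 : lam / s - lam ^ 2 * (E / ((n + 1 : ℕ) : ℝ)) ≤ 1 / ww (n + 1) := by
      have e : ((n + 1 : ℕ) : ℝ) = s ^ 2 := by rw [hs2]; push_cast; ring
      rw [hw, e]
      rw [show s / lam + E = (s + lam * E) / lam by field_simp]
      rw [show lam / s - lam ^ 2 * (E / s ^ 2) = lam * (s - lam * E) / s ^ 2 by field_simp]
      rw [one_div_div, div_le_div_iff₀ (by positivity) (by positivity)]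
      nlinarith [mul_nonneg hl.le (sq_nonneg (lam * E))]
    have c2 : 2 * s' ≤ 2 * s + 1 / s := by
      have : 0 < 2 * s + 1 / s := by positivity
      have e : (2 * s + 1 / s) ^ 2 = 4 * s ^ 2 + 4 + 1 / s ^ 2 := by field_simp; ring
      have : 0 ≤ 1 / s ^ 2 := by positivity
      apply le_of_sq_le_sq _ (by positivity)
      rw [e]; nlinarith
    have c3 : lam * (2 * s') ≤ lam * (2 * s + 1 / s) := by gcongr
    have c4 : lam * (1 / s) = lam / s := by ring
    rw [mul_add] at c3
    rw [mul_add]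
    linarith

lemma PP_lower (n : ℕ) (hn : 1 ≤ n) :
    Real.exp (2 * lam * √(n : ℝ) - 8 - 2 * (11 + Real.log n) ^ 2) ≤ n ^ 2 * PP n := by
  refine le_trans ?_ (QQ_le_sq n)
  refine le_trans ?_ (QQ_lower n hn)
  rw [Real.exp_le_exp]
  have hl := lam_pos
  have h1 : √(n : ℝ) ≤ √((n : ℝ) + 1) := Real.sqrt_le_sqrt (by linarith)
  have h2 : √(2 : ℝ) ≤ 2 := by
    rw [Real.sqrt_le_left (by norm_num)]; norm_num
  have h3 : ∑ j ∈ Icc 1 n, (HH j + 10) / (j : ℝ) ≤ (11 + Real.log n) ^ 2 := by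
    have hH := HH_le n
    have hH0 := HH_nonneg n
    calc _ ≤ ∑ j ∈ Icc 1 n, (HH n + 10) * (1 / (j : ℝ)) := by
          apply Finset.sum_le_sum
          intro j hj
          have := HH_mono (Finset.mem_Icc.1 hj).2
          rw [mul_one_div]
          gcongr
      _ = (HH n + 10) * HH n := by rw [← Finset.mul_sum]; rfl
      _ ≤ _ := by nlinarith
  have h4 := lam_sq_le
  have h5 := lam_le_two
  have h6 : lam * √2 ≤ 2 * 2 := by gcongr
  have h7 : lam * √(n : ℝ) ≤ lam * √((n : ℝ) + 1) := by gcongr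
  have h8 : lam ^ 2 * ∑ j ∈ Icc 1 n, (HH j + 10) / (j : ℝ) ≤ 2 * (11 + Real.log n) ^ 2 := by
    apply mul_le_mul h4 h3 _ (by norm_num)
    apply Finset.sum_nonneg
    intro j _
    have := HH_nonneg j
    positivity
  linarith

lemma gen_bound (t : ℝ) (ht : 0 < t) (N : ℕ) :
    ∏ j ∈ range N, (1 - Real.exp (-t) ^ (j + 1))⁻¹ ≤
      Real.exp (lam ^ 2 / t - Real.exp (-t) ^ (N + 1) / t) := by
  obtain ⟨q, hq⟩ : ∃ q, q = Real.exp (-t) := ⟨_, rfl⟩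
  rw [← hq]
  have h0 : 0 < q := by rw [hq]; exact Real.exp_pos _
  have h1 : q < 1 := by rw [hq, Real.exp_lt_one_iff]; linarith
  have hpos : ∀ j : ℕ, 0 < 1 - q ^ (j + 1) := fun j => by
    have := pow_lt_one₀ h0.le h1 (Nat.succ_ne_zero j)
    simpa using this
  have e1 : ∏ j ∈ range N, (1 - q ^ (j + 1))⁻¹ =
      Real.exp (∑ j ∈ range N, -Real.log (1 - q ^ (j + 1))) := by
    rw [Real.exp_sum]
    apply Finset.prod_congr rfl
    intro j _
    rw [Real.exp_neg, Real.exp_log (hpos j)]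
  rw [e1, Real.exp_le_exp]
  have hs : HasSum (fun k : ℕ => ∑ j ∈ range N, (q ^ (j + 1)) ^ (k + 1) / ((k : ℝ) + 1))
      (∑ j ∈ range N, -Real.log (1 - q ^ (j + 1))) := by
    apply hasSum_sum
    intro j _
    apply Real.hasSum_pow_div_log_of_abs_lt_one
    rw [abs_of_nonneg (by positivity)]
    linarith [hpos j]
  have hz : HasSum (fun k : ℕ => (1 / ((k : ℝ) + 1) ^ 2) * (1 / t)) (lam ^ 2 * (1 / t)) := by
    apply HasSum.mul_right
    have := (hasSum_nat_add_iff' 1).2 hasSum_zeta_two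
    rw [lam_sq]
    simpa using this
  have hz2 := hz.sub (hasSum_ite_eq (0 : ℕ) (q ^ (N + 1) / t))
  have : lam ^ 2 / t - q ^ (N + 1) / t = lam ^ 2 * (1 / t) - q ^ (N + 1) / t := by ring
  rw [this]
  refine hasSum_le ?_ hs hz2
  intro k
  -- geometric sum
  have geo : ∀ r : ℝ, r < 1 → ∑ j ∈ range N, r ^ (j + 1) = (r - r ^ (N + 1)) / (1 - r) := by
    intro r hr
    rw [eq_div_iff (by linarith)]
    clear hs e1 hz2 this
    induction N with
    | zero => simp
    | succ N ih => rw [Finset.sum_range_succ, add_mul, ih]; ring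
  obtain ⟨r, hr⟩ : ∃ r, r = q ^ (k + 1) := ⟨_, rfl⟩
  have hr0 : 0 < r := by rw [hr]; positivity
  have hr1 : r < 1 := by linarith [hpos k]
  have hre : r = Real.exp (-((k + 1) * t)) := by
    rw [hr, hq, ← Real.exp_nat_mul]; congr 1; push_cast; ring
  have e2 : ∑ j ∈ range N, (q ^ (j + 1)) ^ (k + 1) / ((k : ℝ) + 1) =
      (r - r ^ (N + 1)) / (1 - r) / ((k : ℝ) + 1) := by
    rw [← Finset.sum_div, ← geo r hr1]
    congr 1
    apply Finset.sum_congr rfl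
    intro j _
    rw [hr, ← pow_mul, ← pow_mul, mul_comm]
  have hk : (0 : ℝ) < (k : ℝ) + 1 := by positivity
  have hu : r / (1 - r) ≤ 1 / ((k + 1) * t) := by
    have h3 : (k + 1) * t + 1 ≤ 1 / r := by
      rw [hre, one_div, ← Real.exp_neg, neg_neg]; exact Real.add_one_le_exp _
    rw [le_div_iff₀ hr0] at h3
    rw [div_le_div_iff₀ (by linarith) (by positivity)]
    nlinarith
  have hmain : r / (1 - r) / ((k : ℝ) + 1) ≤ 1 / ((k : ℝ) + 1) ^ 2 * (1 / t) := by
    rw [div_le_iff₀ hk]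
    refine hu.trans (le_of_eq ?_)
    field_simp
  rw [e2, sub_div, sub_div]
  rcases Nat.eq_zero_or_pos k with rfl | hkpos
  · simp only [if_true]
    have hrq : r = q := by rw [hr]; simp
    have : q ^ (N + 1) / t ≤ r ^ (N + 1) / (1 - r) / (((0 : ℕ) : ℝ) + 1) := by
      rw [hrq]
      simp only [Nat.cast_zero, zero_add, div_one]
      apply div_le_div_of_nonneg_left (by positivity) (by linarith)
      have := Real.add_one_le_exp (-t)
      rw [← hq] at this; linarith
    linarith
  · rw [if_neg (by omega)]
    have : 0 ≤ r ^ (N + 1) / (1 - r) / ((k : ℝ) + 1) := by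
      have : 0 < 1 - r := by linarith
      positivity
    linarith

lemma log4_ge (M : ℕ) (hM : 1 ≤ M) : 1 ≤ Real.log (4 * M) := by
  rw [Real.le_log_iff_exp_le (by positivity)]
  have : (1 : ℝ) ≤ M := by exact_mod_cast hM
  linarith [Real.exp_one_lt_d9]

lemma QQ_le_PP (M : ℕ) (hM : 1 ≤ M) :
    QQ M ≤ 8 * ww M ^ 2 * Real.log (4 * M) ^ 2 * PP M := by
  have hw := ww_ge M
  have hl := log4_ge M hM
  have hM' : (1 : ℝ) ≤ M := by exact_mod_cast hM
  set w := ww M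
  set l := Real.log (4 * M) with hldef
  obtain ⟨s, hs⟩ : ∃ s, s = ⌈w * l⌉₊ := ⟨_, rfl⟩
  have hwl : 10 ≤ w * l := by nlinarith
  have s1 : w * l ≤ s := by rw [hs]; exact Nat.le_ceil _
  have s2 : (s : ℝ) ≤ 2 * (w * l) := by
    have := Nat.ceil_lt_add_one (by linarith : 0 ≤ w * l)
    rw [hs]; linarith
  have hP := PP_pos M
  have key : QQ M ≤ 2 * s ^ 2 * PP M := by
    rcases le_total s M with h | h
    · obtain ⟨m, rfl⟩ : ∃ m, M = m + s := ⟨M - s, by omega⟩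
      have a := QQ_le' m s
      have b := QQ_decay m s
      have c : Real.exp (-(s / w)) ≤ 1 / (4 * ((m + s : ℕ) : ℝ)) := by
        rw [one_div, ← Real.exp_log (by positivity : (0 : ℝ) < (4 * ((m + s : ℕ) : ℝ))),
          ← Real.exp_neg, Real.exp_le_exp, neg_le_neg_iff, le_div_iff₀ (by linarith)]
        rw [← hldef]; linarith
      have hQ := QQ_nonneg (m + s)
      have d : ((s : ℝ) + 1) * QQ m ≤ QQ (m + s) / 2 := by
        have hsM : (s : ℝ) + 1 ≤ 2 * ((m + s : ℕ) : ℝ) := by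
          have : (s : ℝ) ≤ ((m + s : ℕ) : ℝ) := by exact_mod_cast h
          linarith
        calc ((s : ℝ) + 1) * QQ m ≤ (2 * ((m + s : ℕ) : ℝ)) *
              (QQ (m + s) * (1 / (4 * ((m + s : ℕ) : ℝ)))) := by
              apply mul_le_mul hsM _ (QQ_nonneg m) (by positivity)
              exact b.trans (mul_le_mul_of_nonneg_left c hQ)
          _ = _ := by field_simp; ring
      linarith
    · have a := QQ_le_sq M
      have : (M : ℝ) ≤ s := by exact_mod_cast h
      have : (M : ℝ) ^ 2 ≤ s ^ 2 := by gcongr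
      nlinarith
  have : (s : ℝ) ^ 2 ≤ (2 * (w * l)) ^ 2 := by gcongr
  nlinarith

lemma PP_ratio (M k : ℕ) (hM : 1 ≤ M) (hk : k ≤ M) :
    PP (M - k) ≤ 16 * Real.exp 2 * Real.log (4 * M) ^ 2 * Real.exp (-(k / ww M)) * PP M := by
  have hw := ww_ge M
  have hl := log4_ge M hM
  have hQP := QQ_le_PP M hM
  set w := ww M with hwdef
  set l := Real.log (4 * M) with hldef
  obtain ⟨r, hr⟩ : ∃ r, r = ⌈w⌉₊ := ⟨_, rfl⟩
  have r1 : w ≤ r := by rw [hr]; exact Nat.le_ceil _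
  have r2 : (r : ℝ) ≤ 2 * w := by
    have := Nat.ceil_lt_add_one (by linarith : 0 ≤ w)
    rw [hr]; linarith
  have hP := PP_pos M
  have hrw : (r : ℝ) / w ≤ 2 := by rw [div_le_iff₀ (by linarith)]; exact r2
  rcases le_total r k with h | h
  · have a := QQ_ge (M - k) r
    have b := QQ_decay (M - k + r) (k - r)
    have e : M - k + r + (k - r) = M := by omega
    rw [e, ← hwdef, Nat.cast_sub h] at b
    have hw2 : w ^ 2 ≤ (r : ℝ) ^ 2 := by gcongr
    have c : Real.exp (-((k - r : ℝ) / w)) ≤ Real.exp 2 * Real.exp (-(k / w)) := by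
      rw [← Real.exp_add, Real.exp_le_exp, sub_div]; linarith
    have hPk := PP_pos (M - k)
    have d : w ^ 2 / 2 * PP (M - k) ≤
        8 * w ^ 2 * l ^ 2 * PP M * (Real.exp 2 * Real.exp (-(k / w))) := by
      calc _ ≤ (r : ℝ) ^ 2 / 2 * PP (M - k) := by gcongr
        _ ≤ _ := a
        _ ≤ _ := b
        _ ≤ _ := by gcongr
    have hw0 : 0 < w ^ 2 / 2 := by positivity
    apply le_of_mul_le_mul_left _ hw0
    refine d.trans (le_of_eq ?_)
    ring
  · have hkr : (k : ℝ) / w ≤ 2 := le_trans (by gcongr) hrw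
    have c : 1 ≤ Real.exp 2 * Real.exp (-(k / w)) := by
      rw [← Real.exp_add, Real.one_le_exp_iff]; linarith
    have hl2 : 1 ≤ l ^ 2 := by nlinarith
    have h1 := PP_mono (Nat.sub_le M k)
    have : 1 ≤ 16 * Real.exp 2 * l ^ 2 * Real.exp (-(k / w)) := by
      have : 16 * Real.exp 2 * l ^ 2 * Real.exp (-(k / w)) =
        16 * (l ^ 2 * (Real.exp 2 * Real.exp (-(k / w)))) := by ring
      rw [this]
      nlinarith
    nlinarith

lemma growth (C δ : ℝ) (hδ : 0 < δ) (k : ℕ) :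
    ∀ᶠ M : ℕ in Filter.atTop, C * Real.log M ^ k < Real.exp (δ * Real.log M) := by
  have h1 : Filter.Tendsto (fun M : ℕ => Real.log (M : ℝ)) Filter.atTop Filter.atTop :=
    Real.tendsto_log_atTop.comp tendsto_natCast_atTop_atTop
  refine h1.eventually (p := fun l => C * l ^ k < Real.exp (δ * l)) ?_
  have h2 := (Real.tendsto_pow_mul_exp_neg_atTop_nhds_zero k).comp
    (Filter.tendsto_id.const_mul_atTop hδ)
  have h3 := h2.const_mul (C / δ ^ k)
  rw [mul_zero] at h3
  filter_upwards [h3.eventually (gt_mem_nhds one_pos)] with l hl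
  simp only [Function.comp, id] at hl
  have e : C / δ ^ k * ((δ * l) ^ k * Real.exp (-(δ * l))) =
      C * l ^ k / Real.exp (δ * l) := by
    rw [mul_pow, Real.exp_neg]; field_simp
  rw [e, div_lt_one (Real.exp_pos _)] at hl
  exact hl

lemma sqrt_nat_eq_exp (M : ℕ) (hM : 1 ≤ M) : √(M : ℝ) = Real.exp (Real.log M / 2) := by
  have hM' : (0 : ℝ) < M := by exact_mod_cast hM
  rw [Real.exp_half, Real.exp_log hM']

lemma ww_le (δ : ℝ) (hδ : 0 < δ) :
    ∀ᶠ M : ℕ in Filter.atTop, ww M ≤ (1 + δ) * √(M : ℝ) / lam := by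
  filter_upwards [growth (12 * lam / δ) (1 / 2) (by norm_num) 1, Filter.eventually_ge_atTop 3]
    with M h hM
  have hl := lam_pos
  have hH := HH_le M
  have hl1 : 1 ≤ Real.log M := by
    rw [Real.le_log_iff_exp_le (by positivity)]
    have : (3 : ℝ) ≤ M := by exact_mod_cast hM
    linarith [Real.exp_one_lt_d9]
  rw [pow_one, show 1 / 2 * Real.log (M : ℝ) = Real.log M / 2 by ring,
    ← sqrt_nat_eq_exp M (by omega)] at h
  unfold ww
  have : 12 * Real.log M ≤ δ * √(M : ℝ) / lam := by
    rw [le_div_iff₀ hl]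
    have : 12 * lam / δ * Real.log M = (12 * Real.log M * lam) / δ := by ring
    rw [this, div_lt_iff₀ hδ] at h
    linarith
  rw [add_mul, add_div, one_mul]
  linarith

lemma upper_part (Ncr : ℕ → ℕ)
    (hmax : ∀ M : ℕ, 0 < M → ∀ N : ℕ,
      partitionsWithParts M N ≤ partitionsWithParts M (Ncr M)) (ε : ℝ) (hε : 0 < ε) (hε1 : ε ≤ 1) :
    ∀ᶠ M : ℕ in Filter.atTop,
      (Ncr M : ℝ) ≤ (1 + ε) / (2 * lam) * (√(M : ℝ) * Real.log M) := by
  filter_upwards [ww_le (ε / 4) (by linarith), ww_le (1 / 10) (by norm_num),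
    growth (16 * Real.exp 2 * 9 * 6) (ε / 8) (by linarith) 3, Filter.eventually_ge_atTop 4]
    with M hw1 hw2 hg hM
  by_contra! hN
  have hM' : (4 : ℝ) ≤ M := by exact_mod_cast hM
  have hl := lam_pos
  have hl15 : 1.2 ≤ lam := by nlinarith [lam_sq_ge]
  have hLn : 1 ≤ Real.log M := by
    rw [Real.le_log_iff_exp_le (by positivity)]
    linarith [Real.exp_one_lt_d9]
  have hlog4 : Real.log (4 * M) ≤ 3 * Real.log M := by
    have h4 : Real.log 4 ≤ Real.log M := Real.log_le_log (by norm_num) hM'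
    rw [Real.log_mul (by norm_num) (by positivity)]
    linarith
  have hlog4' := log4_ge M (by omega)
  have hw := ww_ge M
  obtain ⟨N, hNdef⟩ : ∃ N, N = Ncr M := ⟨_, rfl⟩
  have hsum := sum_pwp M
  have hmx := hmax M (by omega)
  rw [← hNdef] at hN hmx
  have hNM : N ≤ M := by
    by_contra! h
    have h0 := pwp_eq_zero h
    have : ∑ i ∈ range (M + 1), partitionsWithParts M i = 0 := by
      apply Finset.sum_eq_zero
      intro i _
      have := hmx i
      omega
    have hp := PP_pos M
    unfold PP at hp
    rw [← hsum, this] at hp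
    simp at hp
  have hsexp := sqrt_nat_eq_exp M (by omega)
  have hMexp : (M : ℝ) = Real.exp (Real.log M) := (Real.exp_log (by linarith)).symm
  have hsM : 0 < √(M : ℝ) := by rw [hsexp]; exact Real.exp_pos _
  set s := √(M : ℝ) with hs
  set l := Real.log (M : ℝ) with hldef
  set w := ww M with hwdef
  have hws : w ≤ s := by
    refine hw2.trans ?_
    rw [div_le_iff₀ hl]; nlinarith
  obtain ⟨T, hT⟩ : ∃ T, T = ⌈3 * (s * l)⌉₊ := ⟨_, rfl⟩
  have hsl : 10 ≤ s * l := by nlinarith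
  have T1 : 3 * (s * l) ≤ T := by rw [hT]; exact Nat.le_ceil _
  have T2 : (T : ℝ) ≤ 4 * (s * l) := by
    have := Nat.ceil_lt_add_one (by linarith : 0 ≤ 3 * (s * l))
    rw [hT]; linarith
  set K := 16 * Real.exp 2 * Real.log (4 * M) ^ 2 with hK
  have hK0 : 0 ≤ K := by positivity
  have hP := PP_pos M
  have e1 : Real.exp (-(N / w)) ≤ Real.exp (-(l / 2 + ε / 8 * l)) := by
    rw [Real.exp_le_exp, neg_le_neg_iff, le_div_iff₀ (by linarith)]
    calc _ ≤ (l / 2 + ε / 8 * l) * ((1 + ε / 4) * s / lam) := by gcongr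
      _ = (1 + ε / 4) ^ 2 / (2 * lam) * (s * l) := by field_simp; ring
      _ ≤ (1 + ε) / (2 * lam) * (s * l) := by gcongr; nlinarith
      _ ≤ N := hN.le
  have e2 : Real.exp (-(T / w)) ≤ Real.exp (-(3 * l)) := by
    rw [Real.exp_le_exp, neg_le_neg_iff, le_div_iff₀ (by linarith)]
    calc 3 * l * w ≤ 3 * l * s := by gcongr
      _ ≤ T := by linarith
  have hterm : ∀ i ∈ range (M + 1), (partitionsWithParts M i : ℝ) ≤
      (if i < T then K * Real.exp (-(N / w)) * PP M else 0) + K * Real.exp (-(T / w)) * PP M := by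
    intro i hi
    have hi : i ≤ M := by simp at hi; omega
    split_ifs with h
    · have a : (partitionsWithParts M i : ℝ) ≤ PP (M - N) := by
        unfold PP; exact_mod_cast (hmx i).trans (pwp_le M N hNM)
      have b := PP_ratio M N (by omega) hNM
      have : 0 ≤ K * Real.exp (-(T / w)) * PP M := by positivity
      linarith
    · have a : (partitionsWithParts M i : ℝ) ≤ PP (M - i) := by
        unfold PP; exact_mod_cast (pwp_le M i hi)
      have b := PP_ratio M i (by omega) hi
      have c : Real.exp (-(i / w)) ≤ Real.exp (-(T / w)) := by
        have : (T : ℝ) ≤ i := by exact_mod_cast (not_lt.1 h)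
        gcongr
      rw [zero_add]
      refine a.trans (b.trans ?_)
      gcongr
  have hPsum : PP M = ∑ i ∈ range (M + 1), (partitionsWithParts M i : ℝ) := by
    unfold PP; rw [← hsum]; push_cast; rfl
  have hcard : (((range (M + 1)).filter (fun i => i < T)).card : ℝ) ≤ T := by
    have : ((range (M + 1)).filter (fun i => i < T)).card ≤ (range T).card := by
      apply Finset.card_le_card
      intro x; simp
    rw [Finset.card_range] at this
    exact_mod_cast this
  have htot : PP M ≤ T * (K * Real.exp (-(N / w)) * PP M) +
      (M + 1) * (K * Real.exp (-(T / w)) * PP M) := by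
    calc PP M = _ := hPsum
      _ ≤ _ := Finset.sum_le_sum hterm
      _ = ((range (M + 1)).filter (fun i => i < T)).card * (K * Real.exp (-(N / w)) * PP M) +
        (M + 1) * (K * Real.exp (-(T / w)) * PP M) := by
          rw [Finset.sum_add_distrib, ← Finset.sum_filter]; simp
      _ ≤ _ := by gcongr
  have htot2 : 1 ≤ K * (T * Real.exp (-(N / w)) + (M + 1) * Real.exp (-(T / w))) := by
    apply le_of_mul_le_mul_right _ hP
    rw [one_mul]
    refine htot.trans (le_of_eq ?_)
    ring
  have hx : 0 < Real.exp (ε / 8 * l) := Real.exp_pos _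
  have f1 : T * Real.exp (-(N / w)) ≤ 4 * l * Real.exp (-(ε / 8 * l)) := by
    calc _ ≤ 4 * (s * l) * Real.exp (-(l / 2 + ε / 8 * l)) := by gcongr
      _ = _ := by
        rw [hsexp, neg_add, Real.exp_add, Real.exp_neg (l / 2)]
        field_simp
  have f2 : (M + 1) * Real.exp (-(T / w)) ≤ 2 * l * Real.exp (-(ε / 8 * l)) := by
    calc _ ≤ (2 * Real.exp l) * Real.exp (-(3 * l)) := by
          apply mul_le_mul _ e2 (Real.exp_pos _).le (by positivity)
          rw [← hMexp]; linarith
      _ = 2 * 1 * Real.exp (-(2 * l)) := by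
          rw [mul_assoc, ← Real.exp_add]; ring_nf
      _ ≤ _ := by
          gcongr
          nlinarith
  have f3 : K ≤ 16 * Real.exp 2 * (3 * l) ^ 2 := by
    rw [hK]; gcongr
  have f4 : 1 ≤ (16 * Real.exp 2 * (3 * l) ^ 2) * (6 * l * Real.exp (-(ε / 8 * l))) := by
    refine htot2.trans ?_
    apply mul_le_mul f3 (by linarith) (by positivity) (by positivity)
  have f5 : (16 * Real.exp 2 * (3 * l) ^ 2) * (6 * l * Real.exp (-(ε / 8 * l))) =
      (16 * Real.exp 2 * 9 * 6 * l ^ 3) / Real.exp (ε / 8 * l) := by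
    rw [Real.exp_neg]; field_simp; ring
  rw [f5, le_div_iff₀ hx] at f4
  linarith

set_option maxHeartbeats 1000000 in
lemma lower_part (Ncr : ℕ → ℕ)
    (hmax : ∀ M : ℕ, 0 < M → ∀ N : ℕ,
      partitionsWithParts M N ≤ partitionsWithParts M (Ncr M)) (ε : ℝ) (hε : 0 < ε) :
    ∀ᶠ M : ℕ in Filter.atTop,
      (1 - ε) / (2 * lam) * (√(M : ℝ) * Real.log M) ≤ (Ncr M : ℝ) := by
  filter_upwards [growth (2 * Real.exp 2 * 300) (ε / 2) (by linarith) 2,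
    Filter.eventually_ge_atTop 4] with M hg hM
  by_contra! hN
  have hM' : (4 : ℝ) ≤ M := by exact_mod_cast hM
  have hl := lam_pos
  have hl2 := lam_le_two
  have hLn : 1 ≤ Real.log M := by
    rw [Real.le_log_iff_exp_le (by positivity)]
    linarith [Real.exp_one_lt_d9]
  obtain ⟨N, hNdef⟩ : ∃ N, N = Ncr M := ⟨_, rfl⟩
  have hsum := sum_pwp M
  have hmx := hmax M (by omega)
  rw [← hNdef] at hN hmx
  have hsexp := sqrt_nat_eq_exp M (by omega)
  have hMexp : (M : ℝ) = Real.exp (Real.log M) := (Real.exp_log (by linarith)).symm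
  have hlow := PP_lower M (by omega)
  have hs2 : √(M : ℝ) ^ 2 = M := Real.sq_sqrt (by linarith)
  have hsM : 0 < √(M : ℝ) := by rw [hsexp]; exact Real.exp_pos _
  have hs1 : 1 ≤ √(M : ℝ) := by nlinarith
  set s := √(M : ℝ) with hs
  set l := Real.log (M : ℝ) with hldef
  have hPmax : PP M ≤ (M + 1) * (partitionsWithParts M N : ℝ) := by
    unfold PP
    rw [← hsum]
    push_cast
    calc _ ≤ ∑ i ∈ range (M + 1), (partitionsWithParts M N : ℝ) := by
          apply Finset.sum_le_sum
          intro i _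
          exact_mod_cast hmx i
      _ = _ := by simp
  set t := lam / s with ht
  have ht0 : 0 < t := by positivity
  have hgen := pwp_gen (Real.exp (-t)) (Real.exp_pos _) (by rw [Real.exp_lt_one_iff]; linarith) N M
  have hgb := hgen.trans (gen_bound t ht0 N)
  obtain ⟨q, hq⟩ : ∃ q, q = Real.exp (-t) ^ (N + 1) := ⟨_, rfl⟩
  rw [← hq] at hgb
  have hqM : Real.exp (-t) ^ M = Real.exp (-(lam * s)) := by
    rw [← Real.exp_nat_mul]
    congr 1
    rw [ht, ← hs2]; field_simp
  have ht2 : lam ^ 2 / t - q / t = lam * s - q * s / lam := by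
    rw [ht]; field_simp
  rw [hqM, ht2] at hgb
  have hpw : (partitionsWithParts M N : ℝ) ≤ Real.exp (2 * lam * s - q * s / lam) := by
    have := mul_le_mul_of_nonneg_right hgb (Real.exp_pos (lam * s)).le
    rw [mul_assoc, ← Real.exp_add, ← Real.exp_add, neg_add_cancel, Real.exp_zero, mul_one] at this
    refine this.trans (le_of_eq ?_)
    congr 1; ring
  have hall : Real.exp (2 * lam * s - 8 - 2 * (11 + l) ^ 2) ≤
      Real.exp (1 + 3 * l + (2 * lam * s - q * s / lam)) := by
    refine hlow.trans ?_
    calc (M : ℝ) ^ 2 * PP M ≤ (M : ℝ) ^ 2 * ((M + 1) * Real.exp (2 * lam * s - q * s / lam)) := by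
          gcongr
          exact hPmax.trans (by gcongr)
      _ = (M : ℝ) ^ 2 * (M + 1) * Real.exp (2 * lam * s - q * s / lam) := by ring
      _ ≤ Real.exp (1 + 3 * l) * Real.exp (2 * lam * s - q * s / lam) := by
          gcongr
          rw [Real.exp_add, show 3 * l = ((3 : ℕ) : ℝ) * l by norm_num, Real.exp_nat_mul, ← hMexp]
          have h2 : (2 : ℝ) ≤ Real.exp 1 := by linarith [Real.exp_one_gt_d9]
          have : (M : ℝ) ^ 2 * (M + 1) ≤ 2 * (M : ℝ) ^ 3 := by nlinarith [sq_nonneg (M : ℝ)]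
          refine this.trans ?_
          gcongr
      _ = _ := by rw [← Real.exp_add]
  rw [Real.exp_le_exp] at hall
  have hub : q * s / lam ≤ 300 * l ^ 2 := by nlinarith
  have hqlow : Real.exp (-((1 - ε) * l / 2 + 2)) ≤ q := by
    rw [hq, ← Real.exp_nat_mul, Real.exp_le_exp]
    have h1 : N * t ≤ (1 - ε) * l / 2 := by
      calc N * t ≤ ((1 - ε) / (2 * lam) * (s * l)) * t := by gcongr
        _ = _ := by rw [ht]; field_simp
    have h2 : t ≤ 2 := by rw [ht, div_le_iff₀ hsM]; nlinarith
    push_cast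
    linarith
  have hfin : Real.exp (ε / 2 * l) ≤ 2 * Real.exp 2 * (q * s / lam) := by
    have h1 : Real.exp (ε / 2 * l) = Real.exp 2 * (Real.exp (-((1 - ε) * l / 2 + 2)) * s) := by
      rw [hsexp, ← Real.exp_add, ← Real.exp_add]; congr 1; ring
    have h2 : q * s ≤ 2 * (q * s / lam) := by
      have hq0 : 0 < q := by rw [hq]; positivity
      rw [mul_div_assoc', le_div_iff₀ hl]
      nlinarith [mul_pos hq0 hsM]
    rw [h1]
    calc _ ≤ Real.exp 2 * (q * s) := by gcongr
      _ ≤ Real.exp 2 * (2 * (q * s / lam)) := by gcongr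
      _ = _ := by ring
  have : 2 * Real.exp 2 * (q * s / lam) ≤ 2 * Real.exp 2 * (300 * l ^ 2) := by gcongr
  linarith

theorem erdos_maximizing_parts_asymptotics (Ncr : ℕ → ℕ)
    (hmax : ∀ M : ℕ, 0 < M → ∀ N : ℕ,
      partitionsWithParts M N ≤ partitionsWithParts M (Ncr M)) :
    Filter.Tendsto
      (fun M : ℕ => (Ncr M : ℝ) / (Real.sqrt M * Real.log M))
      Filter.atTop (nhds (Real.sqrt 6 / (2 * Real.pi))) := by
  have hl := lam_pos
  have e : Real.sqrt 6 / (2 * Real.pi) = 1 / (2 * lam) := by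
    unfold lam
    have := Real.pi_pos
    field_simp
  rw [e, tendsto_order]
  have hpos : ∀ M : ℕ, 2 ≤ M → 0 < √(M : ℝ) * Real.log M := by
    intro M hM
    have hM' : (2 : ℝ) ≤ M := by exact_mod_cast hM
    have := Real.log_pos (by linarith : (1 : ℝ) < M)
    positivity
  constructor
  · intro a ha
    rw [lt_div_iff₀ (by positivity)] at ha
    filter_upwards [lower_part Ncr hmax ((1 - a * (2 * lam)) / 2) (by linarith),
      Filter.eventually_ge_atTop 2] with M h hM
    rw [← le_div_iff₀ (hpos M hM)] at h
    refine lt_of_lt_of_le ?_ h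
    rw [lt_div_iff₀ (by positivity)]
    linarith
  · intro b hb
    rw [gt_iff_lt, div_lt_iff₀ (by positivity)] at hb
    filter_upwards [upper_part Ncr hmax (min ((b * (2 * lam) - 1) / 2) 1)
      (lt_min (by linarith) one_pos) (min_le_right _ _),
      Filter.eventually_ge_atTop 2] with M h hM
    rw [← div_le_iff₀ (hpos M hM)] at h
    refine lt_of_le_of_lt h ?_
    rw [div_lt_iff₀ (by positivity)]
    have := min_le_left ((b * (2 * lam) - 1) / 2) 1
    linarith
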